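/- Let b ≥ 2 be a natural number, let q be a prime with q ∤ b, and let k be a natural number with 1 ≤ k ≤ q−1. Then Z_k = { (αq + β(q−1)) mod q(q−1) : α, β ∈ ℕ, 0 ≤ α < q−1, gcd(α, q−1) = 1, b^α ≢ b (mod q), 0 ≤ β < q, and kβ ≡ b − b^α (mod q) }. Moreover, for each admissible α (i.e. with gcd(α, q−1) = 1 and b^α ≢ b (mod q)) the β with 0 ≤ β < q and kβ ≡ b − b^α (mod q) is unique and satisfies gcd(β, q) = 1. -/

import Mathlib

/-- The solution set `Z_k` from the paper. -/
def Zset (b q k : ℕ) : Set ℕ :=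
  {x : ℕ | x < q * (q - 1) ∧ Nat.gcd x (q * (q - 1)) = 1 ∧ b ^ x ≡ k * x + b [MOD q]}

theorem natCast_sub_one_eq_neg_one {q : ℕ} (hq : 1 ≤ q) : ((q - 1 : ℕ) : ZMod q) = -1 := by
  simp [Nat.cast_sub hq]

theorem ZMod.pow_eq_pow_of_modEq_sub_one {q : ℕ} [Fact q.Prime] {a : ZMod q} (ha : a ≠ 0)
    {x y : ℕ} (h : x ≡ y [MOD q - 1]) : a ^ x = a ^ y := by
  rw [← Nat.div_add_mod x (q - 1), ← Nat.div_add_mod y (q - 1),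
    show x % (q - 1) = y % (q - 1) from h]
  simp [pow_add, pow_mul, ZMod.pow_card_sub_one_eq_one ha]

theorem mul_add_mul_sub_one_modEq (q α β : ℕ) (hq : 1 ≤ q) :
    α * q + β * (q - 1) ≡ α [MOD q - 1] := by
  obtain ⟨m, rfl⟩ := Nat.exists_eq_add_of_le' hq
  rw [Nat.add_sub_cancel, show α * (m + 1) + β * m = α + m * (α + β) by ring]
  exact Nat.add_mul_mod_self_left _ _ _

theorem natCast_mul_add_mul_sub_one (q α β : ℕ) (hq : 1 ≤ q) :
    ((α * q + β * (q - 1) : ℕ) : ZMod q) = -β := by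
  simp [natCast_sub_one_eq_neg_one hq]

theorem mul_add_modEq_iff (q k β c b : ℕ) :
    k * β + c ≡ b [MOD q] ↔ (k * β : ZMod q) + c = b := by
  rw [← ZMod.natCast_eq_natCast_iff]
  push_cast
  rfl

theorem stmt_10 (b q k : ℕ) (hb : 2 ≤ b) (hq : q.Prime) (hnd : ¬ q ∣ b)
    (hk1 : 1 ≤ k) (hk2 : k ≤ q - 1) :
    Zset b q k =
      {x : ℕ | ∃ α β : ℕ, α < q - 1 ∧ Nat.gcd α (q - 1) = 1 ∧
        ¬ b ^ α ≡ b [MOD q] ∧ β < q ∧ k * β + b ^ α ≡ b [MOD q] ∧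
        x = (α * q + β * (q - 1)) % (q * (q - 1))} ∧
    ∀ α : ℕ, α < q - 1 → Nat.gcd α (q - 1) = 1 → ¬ b ^ α ≡ b [MOD q] →
      (∃! β : ℕ, β < q ∧ k * β + b ^ α ≡ b [MOD q]) ∧
        ∀ β : ℕ, β < q → k * β + b ^ α ≡ b [MOD q] → Nat.gcd β q = 1 := by
  have : Fact q.Prime := ⟨hq⟩
  have hq1 : 1 ≤ q := hq.one_le
  have hq2 := hq.two_le
  have hb0 : (b : ZMod q) ≠ 0 := by rwa [Ne, ZMod.natCast_eq_zero_iff]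
  have hk0 : (k : ZMod q) ≠ 0 := by
    rw [Ne, ZMod.natCast_eq_zero_iff]
    exact Nat.not_dvd_of_pos_of_lt hk1 (by omega)
  have hco : Nat.Coprime q (q - 1) :=
    (Nat.coprime_self_sub_right hq1).mpr (Nat.coprime_one_right q)
  have coprime_iff (x : ℕ) : Nat.Coprime x q ↔ (x : ZMod q) ≠ 0 := by
    rw [Nat.coprime_comm, hq.coprime_iff_not_dvd, Ne, ZMod.natCast_eq_zero_iff]
  have modEq_iff (α : ℕ) : b ^ α ≡ b [MOD q] ↔ (b : ZMod q) ^ α = b := by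
    rw [← ZMod.natCast_eq_natCast_iff, Nat.cast_pow]
  have beta_ne (α β : ℕ) (hα : ¬ b ^ α ≡ b [MOD q]) (hβ : k * β + b ^ α ≡ b [MOD q]) :
      (β : ZMod q) ≠ 0 := by
    rw [modEq_iff] at hα
    rw [mul_add_modEq_iff, Nat.cast_pow] at hβ
    intro h
    rw [h, mul_zero, zero_add] at hβ
    exact hα hβ
  refine ⟨?_, fun α _ _ hα => ⟨?_, fun β _ hβ => (coprime_iff β).2 (beta_ne α β hα hβ)⟩⟩
  · ext x
    constructor
    · rintro ⟨hx, hg, he⟩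
      obtain ⟨hgq, hgm⟩ := Nat.coprime_mul_iff_right.1 hg
      have hxα : (b : ZMod q) ^ x = (b : ZMod q) ^ (x % (q - 1)) :=
        ZMod.pow_eq_pow_of_modEq_sub_one hb0 (Nat.mod_modEq x (q - 1)).symm
      have he' := (ZMod.natCast_eq_natCast_iff _ _ _).2 he
      push_cast at he'
      rw [hxα] at he'
      have hβ : ((-(x : ZMod q)).val : ZMod q) = -x := ZMod.natCast_zmod_val _
      refine ⟨x % (q - 1), (-(x : ZMod q)).val, Nat.mod_lt _ (by omega), ?_, ?_,
        ZMod.val_lt _, ?_, ?_⟩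
      · rwa [← Nat.gcd_rec, Nat.gcd_comm]
      · rw [modEq_iff, he', add_eq_right]
        exact mul_ne_zero hk0 ((coprime_iff x).1 hgq)
      · rw [mul_add_modEq_iff, hβ, Nat.cast_pow, he']
        ring
      · rw [← Nat.mod_eq_of_lt hx]
        refine (Nat.modEq_and_modEq_iff_modEq_mul hco).1 ⟨?_, ?_⟩
        · rw [Nat.mod_eq_of_lt hx, ← ZMod.natCast_eq_natCast_iff,
            natCast_mul_add_mul_sub_one _ _ _ hq1, hβ, neg_neg]
        · rw [Nat.mod_eq_of_lt hx]
          exact ((mul_add_mul_sub_one_modEq _ _ _ hq1).trans (Nat.mod_modEq _ _)).symm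
    · rintro ⟨α, β, -, hg, hα, -, hβ, hx⟩
      have hmod : x ≡ α * q + β * (q - 1) [MOD q * (q - 1)] := hx ▸ Nat.mod_modEq _ _
      obtain ⟨h₁, h₂⟩ := (Nat.modEq_and_modEq_iff_modEq_mul hco).2 hmod
      have hxα := h₂.trans (mul_add_mul_sub_one_modEq q α β hq1)
      have hxβ : (x : ZMod q) = -β := by
        rw [← natCast_mul_add_mul_sub_one q α β hq1]
        exact (ZMod.natCast_eq_natCast_iff _ _ _).2 h₁
      have hβ0 := beta_ne α β hα hβ
      rw [mul_add_modEq_iff, Nat.cast_pow] at hβ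
      refine ⟨hx ▸ Nat.mod_lt _ (Nat.mul_pos (by omega) (by omega)), ?_, ?_⟩
      · refine Nat.coprime_mul_iff_right.2 ⟨(coprime_iff x).2 ?_, ?_⟩
        · rwa [hxβ, neg_ne_zero]
        · exact hxα.gcd_eq.trans hg
      · rw [← ZMod.natCast_eq_natCast_iff]
        push_cast
        rw [ZMod.pow_eq_pow_of_modEq_sub_one hb0 hxα, hxβ]
        linear_combination hβ
  · refine ⟨(((b : ZMod q) - (b : ZMod q) ^ α) / k).val, ⟨ZMod.val_lt _, ?_⟩, ?_⟩
    · rw [mul_add_modEq_iff, ZMod.natCast_zmod_val, Nat.cast_pow, mul_div_cancel₀ _ hk0]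
      ring
    · rintro β ⟨hlt, hβ⟩
      rw [mul_add_modEq_iff, Nat.cast_pow] at hβ
      rw [← ZMod.val_cast_of_lt hlt]
      congr 1
      rw [eq_div_iff hk0]
      linear_combination hβ
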